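/- arXiv:2301.09346 — 2 statements merged into one kernel-verified Lean document; each statement's English description precedes it below -/
import Mathlib

section
/- Let (Z,d) be a complete metric space that is metrically convex, and let u, v ∈ Z be any two points. Then there exists a closed interval [a₁, a₂] ⊆ ℝ and an isometry φ : [a₁, a₂] → Z such that φ(a₁) = u and φ(a₂) = v. -/
open Metric Set Filter

/-- A set containing `u` and `v`, lying between them, on which the distance to `u` is an
isometry into `ℝ`. -/
structure IsGeodesicSubset {Z : Type*} [MetricSpace Z] (u v : Z) (S : Set Z) : Prop where
  left_mem : u ∈ S
  right_mem : v ∈ S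
  dist_le : ∀ x ∈ S, dist u x ≤ dist u v
  dist_eq : ∀ x ∈ S, ∀ y ∈ S, dist x y = |dist u x - dist u y|

namespace IsGeodesicSubset

variable {Z : Type*} [MetricSpace Z] {u v : Z} {S : Set Z}

theorem pair (u v : Z) : IsGeodesicSubset u v {u, v} where
  left_mem := by simp
  right_mem := by simp
  dist_le := by simp
  dist_eq := by simp [dist_comm v u]

theorem insert (hS : IsGeodesicSubset u v S) {z : Z} (hz : dist u z ≤ dist u v)
    (hzS : ∀ y ∈ S, dist z y = |dist u z - dist u y|) :
    IsGeodesicSubset u v (insert z S) where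
  left_mem := mem_insert_of_mem _ hS.left_mem
  right_mem := mem_insert_of_mem _ hS.right_mem
  dist_le := by
    rintro x (rfl | hx)
    exacts [hz, hS.dist_le x hx]
  dist_eq := by
    rintro x (rfl | hx) y (rfl | hy)
    · simp
    · exact hzS y hy
    · rw [dist_comm, hzS x hx, abs_sub_comm]
    · exact hS.dist_eq x hx y hy

theorem exists_maximal (u v : Z) : ∃ S, Maximal (IsGeodesicSubset u v) S := by
  have hzorn := zorn_subset_nonempty {S | IsGeodesicSubset u v S} ?_ {u, v} (pair u v)
  · obtain ⟨S, -, hS⟩ := hzorn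
    exact ⟨S, hS⟩
  · rintro c hc hchain ⟨T, hT⟩
    refine ⟨⋃₀ c, ⟨⟨T, hT, (hc hT).left_mem⟩, ⟨T, hT, (hc hT).right_mem⟩, ?_, ?_⟩,
      fun _ ↦ subset_sUnion_of_mem⟩
    · rintro x ⟨A, hA, hx⟩
      exact (hc hA).dist_le x hx
    · rintro x ⟨A, hA, hx⟩ y ⟨B, hB, hy⟩
      rcases hchain.total hA hB with h | h
      · exact (hc hB).dist_eq x (h hx) y hy
      · exact (hc hA).dist_eq x hx y (h hy)

theorem mem_of_maximal (hS : Maximal (IsGeodesicSubset u v) S) {z : Z}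
    (hz : dist u z ≤ dist u v) (hzS : ∀ y ∈ S, dist z y = |dist u z - dist u y|) : z ∈ S :=
  hS.2 (hS.1.insert hz hzS) (subset_insert z S) (mem_insert z S)

theorem isClosed_of_maximal (hS : Maximal (IsGeodesicSubset u v) S) : IsClosed S := by
  refine isClosed_of_closure_subset fun z hz ↦ mem_of_maximal hS ?_ fun y hy ↦ ?_
  · exact closure_minimal (t := {z | dist u z ≤ dist u v}) hS.1.dist_le
      (isClosed_le (by fun_prop) (by fun_prop)) hz
  · exact closure_minimal (t := {z | dist z y = |dist u z - dist u y|})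
      (fun x hx ↦ hS.1.dist_eq x hx y hy) (isClosed_eq (by fun_prop) (by fun_prop)) hz

theorem isClosed_image_dist [CompleteSpace Z] (hS : IsGeodesicSubset u v S)
    (hc : IsClosed S) : IsClosed (dist u '' S) := by
  have : CompleteSpace S := hc.completeSpace_coe
  have he : Isometry fun x : S ↦ dist u (x : Z) :=
    Isometry.of_dist_eq fun x y ↦ (hS.dist_eq x x.2 y y.2).symm
  rw [image_eq_range]
  exact he.isClosedEmbedding.isClosed_range

/-- A point between two points of `S` with no points of `S` in between can be added to `S`. -/
theorem mem_of_gap (hS : Maximal (IsGeodesicSubset u v) S) {x y w : Z} (hx : x ∈ S) (hy : y ∈ S)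
    (hxy : dist u x ≤ dist u y) (hgap : ∀ z ∈ S, dist u z ≤ dist u x ∨ dist u y ≤ dist u z)
    (hw : dist x y = dist x w + dist w y) :
    w ∈ S ∧ dist u w = dist u x + dist x w := by
  have hdist : ∀ {a b : Z}, a ∈ S → b ∈ S → dist u a ≤ dist u b →
      dist a b = dist u b - dist u a := fun {a b} ha hb hab ↦ by
    rw [hS.1.dist_eq a ha b hb, abs_sub_comm, abs_of_nonneg (sub_nonneg.2 hab)]
  have hxy' := hdist hx hy hxy
  have huw : dist u w = dist u x + dist x w := by
    linarith [dist_triangle u x w, dist_triangle u w y]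
  refine ⟨mem_of_maximal hS ?_ fun z hz ↦ ?_, huw⟩
  · linarith [hS.1.dist_le y hy, dist_nonneg (x := w) (y := y)]
  · rcases hgap z hz with h | h
    · have hzx := hdist hz hx h
      rw [abs_of_nonneg (by linarith [dist_nonneg (x := x) (y := w)])]
      linarith [dist_triangle u z w, dist_triangle z x w, dist_comm z w]
    · have hyz := hdist hy hz h
      rw [abs_of_nonpos (by linarith [dist_nonneg (x := w) (y := y)])]
      linarith [dist_triangle u w z, dist_triangle w y z]

theorem Icc_subset_image_dist [CompleteSpace Z] (hS : Maximal (IsGeodesicSubset u v) S)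
    (hconv : ∀ u v : Z, u ≠ v → ∃ w : Z, w ≠ u ∧ w ≠ v ∧ dist u v = dist u w + dist w v) :
    Icc 0 (dist u v) ⊆ dist u '' S := by
  intro t ht
  by_contra hmem
  have hclosed := hS.1.isClosed_image_dist (isClosed_of_maximal hS)
  obtain ⟨_, ⟨⟨x, hx, rfl⟩, hx0, hxt⟩, hxmax⟩ :=
    (isCompact_Icc.inter_left hclosed).exists_isGreatest
      ⟨0, ⟨u, hS.1.left_mem, dist_self u⟩, le_rfl, ht.1⟩
  obtain ⟨_, ⟨⟨y, hy, rfl⟩, hty, hyv⟩, hymin⟩ :=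
    (isCompact_Icc.inter_left hclosed).exists_isLeast
      ⟨dist u v, ⟨v, hS.1.right_mem, rfl⟩, ht.2, le_rfl⟩
  have hgap : ∀ z ∈ S, dist u z ≤ dist u x ∨ dist u y ≤ dist u z := fun z hz ↦ by
    rcases le_total (dist u z) t with h | h
    · exact .inl (hxmax ⟨mem_image_of_mem _ hz, dist_nonneg, h⟩)
    · exact .inr (hymin ⟨mem_image_of_mem _ hz, h, hS.1.dist_le z hz⟩)
  have hne : x ≠ y := by
    rintro rfl
    exact hmem ⟨x, hx, le_antisymm hxt hty⟩
  obtain ⟨w, hwx, hwy, hw⟩ := hconv x y hne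
  obtain ⟨hwS, huw⟩ := mem_of_gap hS hx hy (hxt.trans hty) hgap hw
  have hxw := dist_pos.2 hwx.symm
  have hwy := dist_pos.2 hwy
  have hxy := hS.1.dist_eq x hx y hy
  rw [abs_of_nonpos (by linarith)] at hxy
  rcases hgap w hwS with h | h <;> linarith

end IsGeodesicSubset

/-- In a complete metrically convex metric space, any two points `u, v` are
joined by an isometric image of a closed real interval: there exist
`[a₁, a₂] ⊆ ℝ` and a map `φ` which is an isometry on `[a₁, a₂]` with
`φ a₁ = u` and `φ a₂ = v`. -/
theorem exists_isometry_of_metrically_convex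
    {Z : Type*} [MetricSpace Z] [CompleteSpace Z]
    (hconv : ∀ u v : Z, u ≠ v → ∃ w : Z, w ≠ u ∧ w ≠ v ∧
      dist u v = dist u w + dist w v)
    (u v : Z) :
    ∃ (a₁ a₂ : ℝ), a₁ ≤ a₂ ∧ ∃ φ : ℝ → Z,
      (∀ s ∈ Set.Icc a₁ a₂, ∀ t ∈ Set.Icc a₁ a₂, dist (φ s) (φ t) = |s - t|) ∧
      φ a₁ = u ∧ φ a₂ = v := by
  obtain ⟨S, hS⟩ := IsGeodesicSubset.exists_maximal u v
  have : Nonempty Z := ⟨u⟩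
  have hsurj : ∀ t ∈ Icc 0 (dist u v), ∃ x ∈ S, dist u x = t := fun t ht ↦
    IsGeodesicSubset.Icc_subset_image_dist hS hconv ht
  choose! φ hφS hφ using hsurj
  have h0 : (0 : ℝ) ∈ Icc 0 (dist u v) := left_mem_Icc.2 dist_nonneg
  have h1 : dist u v ∈ Icc 0 (dist u v) := right_mem_Icc.2 dist_nonneg
  refine ⟨0, dist u v, dist_nonneg, φ, fun s hs t ht ↦ ?_, (dist_eq_zero.1 (hφ _ h0)).symm, ?_⟩
  · rw [hS.1.dist_eq _ (hφS s hs) _ (hφS t ht), hφ s hs, hφ t ht]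
  · rw [← dist_eq_zero, hS.1.dist_eq _ (hφS _ h1) _ hS.1.right_mem, hφ _ h1, sub_self, abs_zero]
end

section
/- Let r > 0, let (Z,d) be a complete metric space that is metrically convex, and let F be a map from Z to the nonempty closed bounded subsets of Z. Suppose there exists a function k : [0,∞) → [0,1) satisfying limsup_{t→s⁺} k(t) < 1 for every s ∈ [0,∞), such that H(Fy, Fz) ≤ k(d(y,z))·d(y,z) for all y, z ∈ Z with d(y,z) < r, where H denotes the Hausdorff distance. Then F is a Feng–Liu contraction: there exist constants α, c with 0 ≤ α < c < 1 such that for every y ∈ Z there exists z ∈ Fy satisfying c·d(y,z) ≤ D(y, Fy) and D(z, Fz) ≤ α·d(y,z). -/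
open Metric Set Filter

/-- An Ekeland-type principle: a preorder with closed upper sets on a complete metric space that is
controlled by a nonnegative potential has a maximal element above every point. -/
theorem exists_maximal_of_dist_le_sub {X : Type*} [MetricSpace X] [CompleteSpace X]
    (R : X → X → Prop) (φ : X → ℝ) (hφ : ∀ x, 0 ≤ φ x) (hrefl : ∀ x, R x x)
    (htrans : ∀ x y z, R x y → R y z → R x z) (hclosed : ∀ x, IsClosed {y | R x y})
    (hdist : ∀ x y, R x y → dist x y ≤ φ x - φ y) (u : X) :
    ∃ w, R u w ∧ ∀ y, R w y → y = w := by
  have hstep : ∀ (n : ℕ) (x : X), ∃ y, R x y ∧ ∀ z, R y z → dist y z ≤ (1 / 2 : ℝ) ^ n := by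
    intro n x
    have hne : (φ '' {y | R x y}).Nonempty := ⟨_, x, hrefl x, rfl⟩
    have hbdd : BddBelow (φ '' {y | R x y}) := ⟨0, by rintro _ ⟨y, -, rfl⟩; exact hφ y⟩
    obtain ⟨_, ⟨y, hy, rfl⟩, hlt⟩ := exists_lt_of_csInf_lt hne
      (lt_add_of_pos_right (sInf (φ '' {y | R x y})) (by positivity : (0 : ℝ) < (1 / 2 : ℝ) ^ n))
    refine ⟨y, hy, fun z hz => ?_⟩
    have h₁ := csInf_le hbdd ⟨z, htrans x y z hy hz, rfl⟩
    have h₂ := hdist y z hz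
    linarith
  choose f hfR hfd using hstep
  let s : ℕ → X := fun n => Nat.rec u (fun n x => f n x) n
  have hs : ∀ n, s (n + 1) = f n (s n) := fun n => rfl
  have hsR : ∀ n m, n ≤ m → R (s n) (s m) := by
    intro n m hnm
    induction m, hnm using Nat.le_induction with
    | base => exact hrefl _
    | succ m _ ih => exact htrans _ _ _ ih (hs m ▸ hfR m (s m))
  have hsd : ∀ n z, R (s (n + 1)) z → dist (s (n + 1)) z ≤ (1 / 2 : ℝ) ^ n :=
    fun n z hz => hfd n (s n) z hz
  have hpow : Tendsto (fun n : ℕ => (1 / 2 : ℝ) ^ n) atTop (nhds 0) :=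
    tendsto_pow_atTop_nhds_zero_of_lt_one (by norm_num) (by norm_num)
  have hcauchy : CauchySeq fun n => s (n + 1) :=
    cauchySeq_of_le_tendsto_0' _ (fun n m hnm => hsd n _ (hsR (n + 1) (m + 1) (by lia))) hpow
  obtain ⟨w, hw⟩ := cauchySeq_tendsto_of_complete hcauchy
  have hsw : ∀ n, R (s n) w := fun n =>
    (hclosed (s n)).mem_of_tendsto hw <| by
      filter_upwards [eventually_ge_atTop n] with m hm
      exact hsR n (m + 1) (by lia)
  refine ⟨w, hsw 0, fun y hy => ?_⟩
  have hlim : Tendsto (fun n => s (n + 1)) atTop (nhds y) :=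
    tendsto_iff_dist_tendsto_zero.2 <|
      squeeze_zero (fun _ => dist_nonneg) (fun n => hsd n y (htrans _ _ _ (hsw (n + 1)) hy)) hpow
  exact tendsto_nhds_unique hlim hw

/-- In a complete metrically convex space, there are points metrically between two distinct points
that are arbitrarily close to the first one. -/
theorem exists_between_dist_lt {X : Type*} [MetricSpace X] [CompleteSpace X]
    (hconv : ∀ u v : X, u ≠ v → ∃ w : X, w ≠ u ∧ w ≠ v ∧ dist u v = dist u w + dist w v)
    {δ : ℝ} (hδ : 0 < δ) {u v : X} (huv : u ≠ v) :
    ∃ x, x ≠ u ∧ dist u x < δ ∧ dist u x + dist x v = dist u v := by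
  rcases lt_or_ge (dist u v) δ with hlt | hge
  · exact ⟨v, huv.symm, hlt, by simp⟩
  obtain ⟨x, ⟨hxv, hxδ⟩, hmax⟩ := exists_maximal_of_dist_le_sub
    (fun x y => dist u y + dist y x = dist u x ∧ (δ ≤ dist u x → δ ≤ dist u y))
    (fun x => dist u x) (fun _ => dist_nonneg) (fun x => by simp)
    (by
      rintro x y z ⟨h₁, h₂⟩ ⟨h₃, h₄⟩
      refine ⟨?_, fun h => h₄ (h₂ h)⟩
      linarith [dist_triangle z y x, dist_triangle u z x])
    (fun x => by
      refine (isClosed_eq (f := fun y => dist u y + dist y x) (g := fun _ => dist u x)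
        (by fun_prop) (by fun_prop)).inter (s₂ := {y | δ ≤ dist u x → δ ≤ dist u y}) ?_
      by_cases h : δ ≤ dist u x
      · simpa [h] using isClosed_le continuous_const (by fun_prop : Continuous fun y => dist u y)
      · simp [h])
    (fun x y h => by linarith [h.1, dist_comm x y]) v
  have hδx := hxδ hge
  have hux : u ≠ x := dist_pos.1 (hδ.trans_le hδx)
  obtain ⟨y, hyu, hyx, hy⟩ := hconv u x hux
  refine ⟨y, hyu, ?_, ?_⟩
  · by_contra! h
    exact hyx (hmax y ⟨hy.symm, fun _ => h⟩)
  · linarith [dist_triangle y x v, dist_triangle u y v]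

/-- On a complete metrically convex space, a local linear bound on a function satisfying the
triangle inequality is a global one. -/
theorem le_mul_dist_of_local {X : Type*} [MetricSpace X] [CompleteSpace X]
    (hconv : ∀ u v : X, u ≠ v → ∃ w : X, w ≠ u ∧ w ≠ v ∧ dist u v = dist u w + dist w v)
    {g : X → X → ℝ} (hg : ∀ x y z, g x z ≤ g x y + g y z)
    {δ q : ℝ} (hδ : 0 < δ) (hloc : ∀ x y, dist x y < δ → g x y ≤ q * dist x y) (u v : X) :
    g u v ≤ q * dist u v := by
  obtain ⟨w, ⟨-, hw⟩, hmax⟩ := exists_maximal_of_dist_le_sub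
    (fun x y => dist x y + dist y v = dist x v ∧ g x y ≤ q * dist x y)
    (fun x => dist x v) (fun _ => dist_nonneg)
    (fun x => ⟨by simp, hloc x x (by simpa using hδ)⟩)
    (by
      rintro x y z ⟨h₁, h₂⟩ ⟨h₃, h₄⟩
      have h : dist x z = dist x y + dist y z := by
        linarith [dist_triangle x y z, dist_triangle x z v]
      exact ⟨by linarith, by rw [h]; linarith [hg x y z]⟩)
    (fun x => by
      refine IsSeqClosed.isClosed fun s y hs hy => ⟨?_, ?_⟩
      · exact (isClosed_eq (f := fun y => dist x y + dist y v) (g := fun _ => dist x v)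
          (by fun_prop) (by fun_prop)).mem_of_tendsto hy (.of_forall fun n => (hs n).1)
      · have hlim : Tendsto (fun n => q * dist x (s n) + q * dist (s n) y) atTop
            (nhds (q * dist x y + q * dist y y)) :=
          ((tendsto_const_nhds.dist hy).const_mul q).add
            ((hy.dist tendsto_const_nhds).const_mul q)
        rw [dist_self, mul_zero, add_zero] at hlim
        refine ge_of_tendsto hlim ?_
        filter_upwards [hy.eventually (Metric.ball_mem_nhds y hδ)] with n hn
        linarith [hg x (s n) y, (hs n).2, hloc (s n) y hn])
    (fun x y h => by linarith [h.1]) u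
  by_cases hwv : w = v
  · rwa [hwv] at hw
  · obtain ⟨x, hxw, hxδ, hx⟩ := exists_between_dist_lt hconv hδ hwv
    exact absurd (hmax x ⟨hx, hloc w x hxδ⟩) hxw

/-- **Main theorem.** On a complete, metrically convex metric space, every
Mizoguchi–Takahashi uniformly local contraction (with radius `r > 0`) is a
Feng–Liu contraction: there exist constants `0 ≤ α < c < 1` such that for every
`y ∈ Z` there is `z ∈ Fy` with `c · d(y,z) ≤ D(y, Fy)` and
`D(z, Fz) ≤ α · d(y,z)`. -/
theorem mizoguchi_takahashi_local_is_feng_liu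
    {Z : Type*} [MetricSpace Z] [CompleteSpace Z]
    (hconv : ∀ u v : Z, u ≠ v → ∃ w : Z, w ≠ u ∧ w ≠ v ∧
      dist u v = dist u w + dist w v)
    (r : ℝ) (hr : 0 < r)
    (F : Z → Set Z)
    (hFne : ∀ z, (F z).Nonempty)
    (hFcl : ∀ z, IsClosed (F z))
    (hFbd : ∀ z, Bornology.IsBounded (F z))
    (k : ℝ → ℝ)
    (hk : ∀ t : ℝ, 0 ≤ t → k t ∈ Set.Ico (0 : ℝ) 1)
    (hklim : ∀ s : ℝ, 0 ≤ s → Filter.limsup k (nhdsWithin s (Set.Ioi s)) < 1)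
    (hcontr : ∀ y z : Z, dist y z < r →
      hausdorffDist (F y) (F z) ≤ k (dist y z) * dist y z) :
    ∃ α c : ℝ, 0 ≤ α ∧ α < c ∧ c < 1 ∧
      ∀ y : Z, ∃ z ∈ F y,
        c * dist y z ≤ infDist y (F y) ∧ infDist z (F z) ≤ α * dist y z := by
  obtain ⟨q, hq, hq1⟩ := exists_between (max_lt (hklim 0 le_rfl) one_pos)
  have hq0 : 0 < q := (le_max_right _ _).trans_lt hq
  have hbdd : IsBoundedUnder (· ≤ ·) (nhdsWithin (0 : ℝ) (Ioi 0)) k :=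
    isBoundedUnder_of_eventually_le (a := 1) <| by
      filter_upwards [self_mem_nhdsWithin] with t ht
      exact (hk t (le_of_lt ht)).2.le
  have hev := eventually_lt_of_limsup_lt ((le_max_left _ _).trans_lt hq) hbdd
  obtain ⟨ε, hε, hεk⟩ := mem_nhdsGT_iff_exists_Ioo_subset.1 hev
  have hfin : ∀ x y, hausdorffEDist (F x) (F y) ≠ ⊤ := fun x y =>
    hausdorffEDist_ne_top_of_nonempty_of_bounded (hFne x) (hFne y) (hFbd x) (hFbd y)
  have hglob : ∀ x y, hausdorffDist (F x) (F y) ≤ q * dist x y := by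
    refine le_mul_dist_of_local hconv (g := fun x y => hausdorffDist (F x) (F y))
      (fun x y z => hausdorffDist_triangle (hfin x y)) (lt_min hr hε) fun x y hxy => ?_
    refine (hcontr x y (hxy.trans_le (min_le_left _ _))).trans ?_
    rcases (dist_nonneg (x := x) (y := y)).eq_or_lt with h | h
    · simp [← h]
    · exact mul_le_mul_of_nonneg_right
        (le_of_lt (hεk ⟨h, hxy.trans_le (min_le_right _ _)⟩)) h.le
  obtain ⟨c, hqc, hc1⟩ := exists_between hq1
  refine ⟨q, c, hq0.le, hqc, hc1, fun y => ?_⟩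
  have hfeng : ∃ z ∈ F y, c * dist y z ≤ infDist y (F y) := by
    rcases (infDist_nonneg (x := y) (s := F y)).eq_or_lt with h | h
    · exact ⟨y, ((hFcl y).mem_iff_infDist_zero (hFne y)).2 h.symm, by simp [← h]⟩
    · have hc0 : 0 < c := hq0.trans hqc
      obtain ⟨z, hz, hlt⟩ := (infDist_lt_iff (hFne y)).1
        ((lt_div_iff₀ hc0).2 (mul_lt_of_lt_one_right h hc1))
      exact ⟨z, hz, by linarith [(lt_div_iff₀ hc0).1 hlt]⟩
  obtain ⟨z, hz, hcz⟩ := hfeng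
  exact ⟨z, hz, hcz, (infDist_le_hausdorffDist_of_mem hz (hfin y z)).trans (hglob y z)⟩
end
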